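/- arXiv:1807.10141 — 7 statements merged into one kernel-verified Lean document; each statement's English description precedes it below -/
import Mathlib

section
/- Let f : ℝ → ℝ be continuous, x₀ ∈ ℝ, v₀ > 0, and define G(x) := ∫_{x₀}^x f(ξ)/2 dξ. Suppose x : [η₀, η₁) → ℝ is twice differentiable with x(η₀) = x₀, x'(η₀) = v₀, x'(η) > 0 for all η, and x''(η) = (f(x(η))/2) · (x'(η))² for all η ∈ [η₀, η₁). Then for every η ∈ [η₀, η₁): η − η₀ = (1/v₀) · ∫_{x₀}^{x(η)} exp(−G(ρ)) dρ. -/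
open MeasureTheory Set

theorem Convex.eq_of_hasDerivWithinAt_zero {s : Set ℝ} (hs : Convex ℝ s) {g : ℝ → ℝ}
    (hg : ∀ t ∈ s, HasDerivWithinAt g 0 s t) {a b : ℝ} (ha : a ∈ s) (hb : b ∈ s) :
    g b = g a := by
  have h := hs.norm_image_sub_le_of_norm_hasDerivWithin_le (C := 0) hg (by simp) ha hb
  rw [zero_mul, norm_le_zero_iff] at h
  exact sub_eq_zero.mp h

theorem affine_length_formula
    (f : ℝ → ℝ) (hf : Continuous f) (x₀ v₀ η₀ η₁ : ℝ) (hv₀ : 0 < v₀)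
    (G : ℝ → ℝ) (hG : ∀ x, G x = ∫ ξ in x₀..x, f ξ / 2)
    (x x' : ℝ → ℝ)
    (hx0 : x η₀ = x₀) (hx'0 : x' η₀ = v₀)
    (hpos : ∀ η ∈ Ico η₀ η₁, 0 < x' η)
    (hd1 : ∀ η ∈ Ico η₀ η₁, HasDerivWithinAt x (x' η) (Ico η₀ η₁) η)
    (hd2 : ∀ η ∈ Ico η₀ η₁, HasDerivWithinAt x' (f (x η) / 2 * (x' η) ^ 2) (Ico η₀ η₁) η) :
    ∀ η ∈ Ico η₀ η₁, η - η₀ = (1 / v₀) * ∫ ρ in x₀..(x η), Real.exp (-(G ρ)) := by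
  intro η hη
  have hη₀ : η₀ ∈ Ico η₀ η₁ := ⟨le_rfl, hη.1.trans_lt hη.2⟩
  have hG' : ∀ y, HasDerivAt G (f y / 2) y := fun y ↦ by
    rw [funext hG]
    exact (hf.div_const 2).integral_hasStrictDerivAt x₀ y |>.hasDerivAt
  have hGc : Continuous G := continuous_iff_continuousAt.2 fun y ↦ (hG' y).continuousAt
  have hconst : ∀ t ∈ Ico η₀ η₁, x' t * Real.exp (-(G (x t))) = v₀ := by
    intro t ht
    have h := (convex_Ico η₀ η₁).eq_of_hasDerivWithinAt_zero
      (g := fun s ↦ x' s * Real.exp (-(G (x s)))) (fun s hs ↦ by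
        refine ((hd2 s hs).mul
          ((hG' (x s)).comp_hasDerivWithinAt s (hd1 s hs)).neg.exp).congr_deriv ?_
        simp only [Pi.neg_apply, Function.comp_apply]
        ring) hη₀ ht
    simpa [hx0, hx'0, hG x₀] using h
  have hE : Continuous fun ρ ↦ Real.exp (-(G ρ)) := Real.continuous_exp.comp hGc.neg
  have h := (convex_Ico η₀ η₁).eq_of_hasDerivWithinAt_zero
    (g := fun s ↦ (∫ ρ in x₀..(x s), Real.exp (-(G ρ))) - v₀ * s) (fun s hs ↦ by
      refine (((hE.integral_hasStrictDerivAt x₀ (x s)).hasDerivAt.comp_hasDerivWithinAt s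
        (hd1 s hs)).sub ((hasDerivWithinAt_id s _).const_mul v₀)).congr_deriv ?_
      rw [← hconst s hs]
      ring) hη₀ hη
  simp only [hx0, intervalIntegral.integral_same] at h
  field_simp
  linarith
end

section
/- Let f : ℝ → ℝ be continuous, k > 0, x₀ ∈ ℝ, and define G(x) := ∫_{x₀}^x f(ξ)/2 dξ. Assume ρ ↦ exp(−G(ρ)) is integrable on [x₀, ∞). Then for every x ∈ ℝ the integral ∫_x^∞ exp(−G(ρ)) dρ is finite, and the function u(x) := (k/2) · exp(G(x)) · ∫_x^∞ exp(−G(ρ)) dρ is differentiable, satisfies u(x) > 0 for all x, and satisfies u'(x) = (f(x)/2) · u(x) − k/2 for all x. -/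
open MeasureTheory Set

/-- A continuous function that is integrable on one right half-line is integrable on all of them. -/
theorem Continuous.integrableOn_Ici_of_integrableOn_Ici {E : ℝ → ℝ} (hE : Continuous E) {a : ℝ}
    (ha : IntegrableOn E (Ici a)) (b : ℝ) : IntegrableOn E (Ici b) := by
  refine ((hE.integrableOn_Icc (a := b) (b := a)).union ha).mono_set fun y hy => ?_
  rcases le_total y a with h | h
  · exact Or.inl ⟨hy, h⟩
  · exact Or.inr h

/-- The derivative of a tail integral with respect to its lower endpoint. -/
theorem Continuous.hasDerivAt_integral_Ici {E : ℝ → ℝ} (hE : Continuous E)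
    (hint : ∀ x, IntegrableOn E (Ici x)) (x : ℝ) :
    HasDerivAt (fun y => ∫ ρ in Ici y, E ρ) (-E x) x := by
  have hfun : (fun y => ∫ ρ in Ici y, E ρ) =
      fun y => (∫ ρ in Ici x, E ρ) - ∫ ρ in x..y, E ρ := by
    funext y
    rw [integral_Ici_eq_integral_Ioi, integral_Ici_eq_integral_Ioi,
      ← intervalIntegral.integral_Ioi_sub_Ioi' ((hint x).mono_set Ioi_subset_Ici_self)
        ((hint y).mono_set Ioi_subset_Ici_self), sub_sub_cancel]
  rw [hfun]
  exact (hE.integral_hasStrictDerivAt x x).hasDerivAt.const_sub _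

theorem rescaling_function_positive_solves_ode
    (f : ℝ → ℝ) (hf : Continuous f) (k x₀ : ℝ) (hk : 0 < k)
    (G : ℝ → ℝ) (hG : ∀ x, G x = ∫ ξ in x₀..x, f ξ / 2)
    (hint : IntegrableOn (fun ρ => Real.exp (-(G ρ))) (Ici x₀)) :
    (∀ x, IntegrableOn (fun ρ => Real.exp (-(G ρ))) (Ici x)) ∧
    (∀ x, 0 < k / 2 * Real.exp (G x) * ∫ ρ in Ici x, Real.exp (-(G ρ))) ∧
    (∀ x, HasDerivAt (fun y => k / 2 * Real.exp (G y) * ∫ ρ in Ici y, Real.exp (-(G ρ)))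
      (f x / 2 * (k / 2 * Real.exp (G x) * ∫ ρ in Ici x, Real.exp (-(G ρ))) - k / 2) x) := by
  have hGd : ∀ x, HasDerivAt G (f x / 2) x := fun x => by
    rw [funext hG]
    exact ((hf.div_const 2).integral_hasStrictDerivAt x₀ x).hasDerivAt
  have hGc : Continuous G := continuous_iff_continuousAt.2 fun x => (hGd x).continuousAt
  have hE : Continuous fun ρ => Real.exp (-(G ρ)) := hGc.neg.rexp
  have hI := hE.integrableOn_Ici_of_integrableOn_Ici hint
  refine ⟨hI, fun x => ?_, fun x => ?_⟩
  · have : NeZero (volume.restrict (Ici x)) := ⟨by simp⟩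
    have hpos : 0 < ∫ ρ in Ici x, Real.exp (-(G ρ)) := integral_exp_pos (hI x)
    positivity
  · have h : Real.exp (G x) * Real.exp (-(G x)) = 1 := by rw [← Real.exp_add]; simp
    refine (((hGd x).exp.const_mul (k / 2)).mul (hE.hasDerivAt_integral_Ici hI x)).congr_deriv ?_
    linear_combination (-(k / 2)) * h
end

section
/- Let f : ℝ → ℝ be continuous, k > 0, x₀ ∈ ℝ, and define G(x) := ∫_{x₀}^x f(ξ)/2 dξ. Assume ρ ↦ exp(−G(ρ)) is integrable on [x₀, ∞), and set u₀ := (k/2) · ∫_{x₀}^∞ exp(−G(ρ)) dρ. Suppose x : [η₀, η₁) → ℝ is twice differentiable with x(η₀) = x₀, x'(η₀) = u₀, x'(η) > 0 for all η, x''(η) = (f(x(η))/2) · (x'(η))² for all η, and x(η) → ∞ as η → η₁⁻. Then η₁ = η₀ + 2/k. -/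
open MeasureTheory Set

/-- Two functions with the same derivative within a convex subset of `ℝ` that agree at one point
of it agree on all of it. -/
theorem Convex.eqOn_of_hasDerivWithinAt_eq {s : Set ℝ} (hs : Convex ℝ s) {g h g' : ℝ → ℝ}
    (hg : ∀ t ∈ s, HasDerivWithinAt g (g' t) s t) (hh : ∀ t ∈ s, HasDerivWithinAt h (g' t) s t)
    {a : ℝ} (ha : a ∈ s) (hgh : g a = h a) : EqOn g h s := by
  intro t ht
  have key := hs.norm_image_sub_le_of_norm_hasDerivWithin_le (f := g - h) (f' := fun _ => 0)
    (C := 0) (fun t ht => by simpa using (hg t ht).sub (hh t ht)) (by simp) ha ht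
  simp only [zero_mul, norm_le_zero_iff, Pi.sub_apply] at key
  linarith

theorem rescaled_generator_has_affine_length_two_over_k
    (f : ℝ → ℝ) (hf : Continuous f) (k x₀ η₀ η₁ : ℝ) (hk : 0 < k) (hη : η₀ < η₁)
    (G : ℝ → ℝ) (hG : ∀ x, G x = ∫ ξ in x₀..x, f ξ / 2)
    (hint : IntegrableOn (fun ρ => Real.exp (-(G ρ))) (Ici x₀))
    (u₀ : ℝ) (hu₀ : u₀ = k / 2 * ∫ ρ in Ici x₀, Real.exp (-(G ρ)))
    (x x' : ℝ → ℝ)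
    (hx0 : x η₀ = x₀) (hx'0 : x' η₀ = u₀)
    (hpos : ∀ η ∈ Ico η₀ η₁, 0 < x' η)
    (hd1 : ∀ η ∈ Ico η₀ η₁, HasDerivWithinAt x (x' η) (Ico η₀ η₁) η)
    (hd2 : ∀ η ∈ Ico η₀ η₁, HasDerivWithinAt x' (f (x η) / 2 * (x' η) ^ 2) (Ico η₀ η₁) η)
    (hblow : Filter.Tendsto x (nhdsWithin η₁ (Ico η₀ η₁)) Filter.atTop) :
    η₁ = η₀ + 2 / k := by
  have hGd (y : ℝ) : HasDerivAt G (f y / 2) y := by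
    rw [funext hG]
    exact ((hf.div_const 2).integral_hasStrictDerivAt x₀ y).hasDerivAt
  have hGc : Continuous fun ρ => Real.exp (-(G ρ)) :=
    Real.continuous_exp.comp
      (continuous_iff_continuousAt.2 fun y => (hGd y).continuousAt).neg
  have hη₀ : η₀ ∈ Ico η₀ η₁ := ⟨le_rfl, hη⟩
  have hfirst : EqOn (fun η => x' η * Real.exp (-(G (x η)))) (fun _ => u₀) (Ico η₀ η₁) := by
    refine (convex_Ico η₀ η₁).eqOn_of_hasDerivWithinAt_eq (g' := fun _ => 0) (fun η h => ?_)
      (fun η _ => hasDerivWithinAt_const _ _ _) hη₀ (by simp [hx0, hx'0, hG])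
    have hexp : HasDerivWithinAt (fun η => Real.exp (-(G (x η))))
        (Real.exp (-(G (x η))) * -(f (x η) / 2 * x' η)) (Ico η₀ η₁) η :=
      ((hGd (x η)).comp_hasDerivWithinAt η (hd1 η h)).neg.exp
    exact ((hd2 η h).mul hexp).congr_deriv (by ring)
  have hsecond : EqOn (fun η => ∫ ρ in x₀..x η, Real.exp (-(G ρ)))
      (fun η => u₀ * (η - η₀)) (Ico η₀ η₁) := by
    refine (convex_Ico η₀ η₁).eqOn_of_hasDerivWithinAt_eq (g' := fun _ => u₀) (fun η h => ?_)
      (fun η _ => ?_) hη₀ (by simp [hx0])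
    · exact ((hGc.integral_hasStrictDerivAt x₀ (x η)).hasDerivAt.comp_hasDerivWithinAt η
        (hd1 η h)).congr_deriv ((mul_comm _ _).trans (hfirst h))
    · simpa using (((hasDerivAt_id η).sub_const η₀).const_mul u₀).hasDerivWithinAt
  have hne : (nhdsWithin η₁ (Ico η₀ η₁)).NeBot := by
    rw [nhdsWithin_Ico_eq_nhdsLT hη]
    infer_instance
  have hlim := intervalIntegral_tendsto_integral_Ioi x₀ (hint.mono_set Ioi_subset_Ici_self) hblow
  rw [← integral_Ici_eq_integral_Ioi] at hlim
  have hlim' : Filter.Tendsto (fun η => u₀ * (η - η₀)) (nhdsWithin η₁ (Ico η₀ η₁))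
      (nhds (u₀ * (η₁ - η₀))) :=
    (Continuous.tendsto (by fun_prop) η₁).mono_left nhdsWithin_le_nhds
  have hI := tendsto_nhds_unique (hlim.congr' (hsecond.eventuallyEq_of_mem self_mem_nhdsWithin))
    hlim'
  have hu : 0 < u₀ := hx'0 ▸ hpos η₀ hη₀
  rw [hI] at hu₀
  have hlen : k * (η₁ - η₀) = 2 := by
    apply mul_left_cancel₀ hu.ne'
    linarith
  field_simp
  linarith
end

section
/- Let f : ℝ → ℝ be continuous, x₀ ∈ ℝ, v₀ > 0, and define G(x) := ∫_{x₀}^x f(ξ)/2 dξ and η : [x₀, ∞) → ℝ by η(x) := (1/v₀) · ∫_{x₀}^x exp(−G(ρ)) dρ. Then η is strictly increasing and twice continuously differentiable with η(x₀) = 0, and, writing T := sup{η(x) : x ≥ x₀} ∈ (0, ∞], the inverse function x := η⁻¹ : [0, T) → [x₀, ∞) is twice differentiable and satisfies x(0) = x₀, x'(0) = v₀, x'(η) > 0 for all η ∈ [0, T), and x''(η) = (f(x(η))/2) · (x'(η))² for all η ∈ [0, T). -/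
open MeasureTheory Set

/-- A function whose derivative is everywhere given by a `C^n` function is `C^(n+1)`. -/
theorem contDiff_succ_of_hasDerivAt {g g' : ℝ → ℝ} {n : ℕ}
    (hg : ∀ x, HasDerivAt g (g' x) x) (hg' : ContDiff ℝ n g') :
    ContDiff ℝ (n + 1) g := by
  have hderiv : deriv g = g' := funext fun x => (hg x).deriv
  rw [contDiff_succ_iff_deriv]
  refine ⟨fun x => (hg x).differentiableAt, by simp, ?_⟩
  rwa [hderiv]

theorem affine_parametrization_exists
    (f : ℝ → ℝ) (hf : Continuous f) (x₀ v₀ : ℝ) (hv₀ : 0 < v₀)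
    (G η : ℝ → ℝ)
    (hG : ∀ x, G x = ∫ ξ in x₀..x, f ξ / 2)
    (hη : ∀ x, η x = (1 / v₀) * ∫ ρ in x₀..x, Real.exp (-(G ρ))) :
    StrictMonoOn η (Ici x₀) ∧ ContDiffOn ℝ 2 η (Ici x₀) ∧ η x₀ = 0 ∧
      ∃ x : ℝ → ℝ,
        (∀ s ∈ η '' Ici x₀, x₀ ≤ x s ∧ η (x s) = s) ∧
        (∀ r ∈ Ici x₀, x (η r) = r) ∧
        x 0 = x₀ ∧
        ∃ x' : ℝ → ℝ, x' 0 = v₀ ∧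
          (∀ s ∈ η '' Ici x₀, 0 < x' s) ∧
          (∀ s ∈ η '' Ici x₀, HasDerivWithinAt x (x' s) (η '' Ici x₀) s) ∧
          (∀ s ∈ η '' Ici x₀,
            HasDerivWithinAt x' (f (x s) / 2 * (x' s) ^ 2) (η '' Ici x₀) s) := by
  have hG' : ∀ r, HasDerivAt G (f r / 2) r := by
    intro r
    rw [funext hG]
    exact (hf.div_const 2).integral_hasStrictDerivAt x₀ r |>.hasDerivAt
  have hG1 : ContDiff ℝ 1 G := by
    simpa using contDiff_succ_of_hasDerivAt (n := 0) hG' (contDiff_zero.2 (hf.div_const 2))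
  have hη' : ∀ r, HasStrictDerivAt η (1 / v₀ * Real.exp (-(G r))) r := by
    intro r
    rw [funext hη]
    exact ((Real.continuous_exp.comp hG1.continuous.neg).integral_hasStrictDerivAt x₀ r).const_mul _
  have hη'_pos : ∀ r, 0 < 1 / v₀ * Real.exp (-(G r)) := fun r => by positivity
  have hmono : StrictMono η :=
    strictMono_of_deriv_pos fun r => (hη' r).hasDerivAt.deriv ▸ hη'_pos r
  have hη2 : ContDiff ℝ 2 η := by
    have := contDiff_succ_of_hasDerivAt (n := 1) (fun r => (hη' r).hasDerivAt)
      (contDiff_const.mul hG1.neg.exp)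
    norm_num at this
    exact this
  have hη0 : η x₀ = 0 := by simp [hη]
  have hG0 : G x₀ = 0 := by simp [hG]
  set x : ℝ → ℝ := Function.invFun η
  have hx : ∀ r, x (η r) = r := Function.leftInverse_invFun hmono.injective
  have hx0 : x 0 = x₀ := by rw [← hη0, hx]
  have hx' : ∀ r, HasDerivAt x (v₀ * Real.exp (G r)) (η r) := by
    intro r
    refine ((hη' r).to_local_left_inverse (hη'_pos r).ne'
      (.of_forall hx)).hasDerivAt.congr_deriv ?_
    rw [Real.exp_neg]
    field_simp
  refine ⟨hmono.strictMonoOn _, hη2.contDiffOn, hη0, x, ?_, fun r _ => hx r, hx0,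
    fun s => v₀ * Real.exp (G (x s)), by simp [hx0, hG0], fun s _ => by positivity, ?_, ?_⟩
  · rintro _ ⟨r, hr, rfl⟩
    rw [hx]
    exact ⟨hr, rfl⟩
  · rintro _ ⟨r, -, rfl⟩
    beta_reduce
    rw [hx]
    exact (hx' r).hasDerivWithinAt
  · rintro _ ⟨r, -, rfl⟩
    have hGx : HasDerivAt (fun s => G (x s)) (f (x (η r)) / 2 * (v₀ * Real.exp (G r))) (η r) :=
      (hG' (x (η r))).comp (η r) (hx' r)
    refine ((hGx.exp.const_mul v₀).congr_deriv ?_).hasDerivWithinAt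
    beta_reduce
    rw [hx]
    ring
end

section
/- Let K be a compact topological space, p₀ ∈ K, x₀ ∈ ℝ, and F : ℝ × K → ℝ continuous. Assume: (i) there exists b ≥ 0 such that |∫_{x₀}^ρ (F(ξ, q) − F(ξ, p₀)) dξ| ≤ b for all q ∈ K and all ρ ≥ x₀; and (ii) ρ ↦ exp(−∫_{x₀}^ρ F(ξ, p₀) dξ) is integrable on [x₀, ∞). Then for every q ∈ K the function ρ ↦ exp(−∫_{x₀}^ρ F(ξ, q) dξ) is integrable on [x₀, ∞), and the function I : K → ℝ, I(q) := ∫_{x₀}^∞ exp(−∫_{x₀}^ρ F(ξ, q) dξ) dρ, is continuous on K. -/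
open MeasureTheory Set

/-- A bound on the primitive of `f - g` compares the weights `exp (-∫ f)` and `exp (-∫ g)`. -/
theorem norm_exp_neg_primitive_le {f g : ℝ → ℝ} (hf : Continuous f) (hg : Continuous g)
    {x₀ b : ℝ} (hbd : ∀ ρ, x₀ ≤ ρ → |∫ ξ in x₀..ρ, (f ξ - g ξ)| ≤ b) :
    ∀ ρ, x₀ ≤ ρ → ‖Real.exp (-(∫ ξ in x₀..ρ, f ξ))‖ ≤
      Real.exp b * Real.exp (-(∫ ξ in x₀..ρ, g ξ)) := by
  intro ρ hρ
  have h := hbd ρ hρ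
  rw [intervalIntegral.integral_sub (hf.intervalIntegrable _ _) (hg.intervalIntegrable _ _)] at h
  rw [Real.norm_eq_abs, Real.abs_exp, ← Real.exp_add, Real.exp_le_exp]
  linarith [(abs_le.mp h).1]

theorem continuous_exp_neg_primitive {f : ℝ → ℝ} (hf : Continuous f) (x₀ : ℝ) :
    Continuous fun ρ => Real.exp (-(∫ ξ in x₀..ρ, f ξ)) :=
  (intervalIntegral.continuous_primitive (fun _ _ => hf.intervalIntegrable _ _) x₀).neg.rexp

theorem continuous_integral_exp_neg_primitive (x₀ b : ℝ) (g : C(ℝ, ℝ))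
    (hint : IntegrableOn (fun ρ => Real.exp (-(∫ ξ in x₀..ρ, g ξ))) (Ici x₀)) :
    Continuous fun f : ({f | ∀ ρ, x₀ ≤ ρ → |∫ ξ in x₀..ρ, (f ξ - g ξ)| ≤ b} : Set C(ℝ, ℝ)) =>
      ∫ ρ in Ici x₀, Real.exp (-(∫ ξ in x₀..ρ, f.1 ξ)) := by
  refine continuous_of_dominated
    (fun f => (continuous_exp_neg_primitive f.1.continuous x₀).aestronglyMeasurable)
    (fun f => ae_restrict_of_forall_mem measurableSet_Ici
      (norm_exp_neg_primitive_le f.1.continuous g.continuous f.2))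
    (hint.const_mul _) (Filter.Eventually.of_forall fun ρ => ?_)
  refine (intervalIntegral.continuous_parametric_intervalIntegral_of_continuous' ?_ x₀ ρ).neg.rexp
  exact (continuous_subtype_val.comp continuous_fst).eval continuous_snd

theorem rescaling_function_continuous_on_compact_label_space
    {K : Type*} [TopologicalSpace K] [CompactSpace K]
    (p₀ : K) (x₀ : ℝ) (F : ℝ × K → ℝ) (hF : Continuous F)
    (b : ℝ) (hb : 0 ≤ b)
    (hbd : ∀ q : K, ∀ ρ, x₀ ≤ ρ → |∫ ξ in x₀..ρ, (F (ξ, q) - F (ξ, p₀))| ≤ b)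
    (hint : IntegrableOn (fun ρ => Real.exp (-(∫ ξ in x₀..ρ, F (ξ, p₀)))) (Ici x₀)) :
    (∀ q : K, IntegrableOn (fun ρ => Real.exp (-(∫ ξ in x₀..ρ, F (ξ, q)))) (Ici x₀)) ∧
      Continuous (fun q : K => ∫ ρ in Ici x₀, Real.exp (-(∫ ξ in x₀..ρ, F (ξ, q)))) := by
  have hF' (q : K) : Continuous fun ξ => F (ξ, q) := by fun_prop
  refine ⟨fun q => (hint.const_mul (Real.exp b)).mono'
    (continuous_exp_neg_primitive (hF' q) x₀).aestronglyMeasurable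
    (ae_restrict_of_forall_mem measurableSet_Ici
      (norm_exp_neg_primitive_le (hF' q) (hF' p₀) (hbd q))), ?_⟩
  -- `K` need not be first countable, but `C(ℝ, ℝ)` is, so dominated convergence is applied there.
  let G : C(K, C(ℝ, ℝ)) := ContinuousMap.curry ⟨fun p : K × ℝ => F (p.2, p.1), by fun_prop⟩
  exact (continuous_integral_exp_neg_primitive x₀ b (G p₀) hint).comp
    (G.continuous.subtype_mk hbd)
end

section
/- Let K be a compact topological space, p₀ ∈ K, x₀ ∈ ℝ, s > 0, and F : ℝ × K → ℝ continuous. Assume: (i) there exists b ≥ 0 such that |∫_{x₀}^ρ (F(ξ, q) − F(ξ, p₀)) dξ| ≤ b for all q ∈ K and all ρ ≥ x₀; and (ii) ρ ↦ exp(−∫_{x₀}^ρ F(ξ, p₀) dξ) is integrable on [x₀, ∞). Then the sequence of functions u_m : K → ℝ, u_m(q) := ∫_{x₀}^{x₀ + m·s} exp(−∫_{x₀}^ρ F(ξ, q) dξ) dρ, converges uniformly on K (as m → ∞) to the function q ↦ ∫_{x₀}^∞ exp(−∫_{x₀}^ρ F(ξ, q) dξ) dρ. -/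
open MeasureTheory Set

/-- A family dominated on `(a, ∞)` by one integrable function has uniformly convergent
improper integrals. -/
theorem tendstoUniformly_intervalIntegral_Ioi_of_dominated {ι K : Type*} {l : Filter ι}
    [l.IsCountablyGenerated]
    {a : ℝ} {T : ι → ℝ} (hT : Filter.Tendsto T l Filter.atTop) {f : K → ℝ → ℝ} {g : ℝ → ℝ}
    (hf : ∀ q, AEStronglyMeasurable (f q) (volume.restrict (Ioi a)))
    (hg : IntegrableOn g (Ioi a)) (hfg : ∀ q, ∀ x ∈ Ioi a, ‖f q x‖ ≤ g x) :
    TendstoUniformly (fun i q => ∫ x in a..T i, f q x) (fun q => ∫ x in Ioi a, f q x) l := by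
  have hfi (q : K) : IntegrableOn (f q) (Ioi a) :=
    Integrable.mono' hg (hf q) (ae_restrict_of_forall_mem measurableSet_Ioi (hfg q))
  have hlim := intervalIntegral_tendsto_integral_Ioi a hg hT
  rw [Metric.tendstoUniformly_iff]
  intro ε hε
  filter_upwards [Metric.tendsto_nhds.1 hlim ε hε, hT.eventually_ge_atTop a] with i hi hai q
  have tail {h : ℝ → ℝ} (hh : IntegrableOn h (Ioi a)) :
      (∫ x in Ioi a, h x) - ∫ x in a..T i, h x = ∫ x in Ioi (T i), h x := by
    rw [← intervalIntegral.integral_interval_add_Ioi hh (hh.mono_set (Ioi_subset_Ioi hai))]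
    ring
  rw [dist_comm, Real.dist_eq, tail hg] at hi
  rw [dist_eq_norm, tail (hfi q)]
  calc ‖∫ x in Ioi (T i), f q x‖ ≤ ∫ x in Ioi (T i), g x :=
        norm_integral_le_of_norm_le (hg.mono_set (Ioi_subset_Ioi hai))
          (ae_restrict_of_forall_mem measurableSet_Ioi
            fun x hx => hfg q x (Ioi_subset_Ioi hai hx))
    _ ≤ |∫ x in Ioi (T i), g x| := le_abs_self _
    _ < ε := hi

theorem truncated_rescaling_integrals_converge_uniformly
    {K : Type*} [TopologicalSpace K] [CompactSpace K]
    (p₀ : K) (x₀ s : ℝ) (hs : 0 < s) (F : ℝ × K → ℝ) (hF : Continuous F)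
    (b : ℝ) (hb : 0 ≤ b)
    (hbd : ∀ q : K, ∀ ρ, x₀ ≤ ρ → |∫ ξ in x₀..ρ, (F (ξ, q) - F (ξ, p₀))| ≤ b)
    (hint : IntegrableOn (fun ρ => Real.exp (-(∫ ξ in x₀..ρ, F (ξ, p₀)))) (Ici x₀)) :
    TendstoUniformly
      (fun (m : ℕ) (q : K) => ∫ ρ in x₀..(x₀ + m * s), Real.exp (-(∫ ξ in x₀..ρ, F (ξ, q))))
      (fun q : K => ∫ ρ in Ici x₀, Real.exp (-(∫ ξ in x₀..ρ, F (ξ, q))))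
      Filter.atTop := by
  have hFi (q : K) (c d : ℝ) : IntervalIntegrable (fun ξ => F (ξ, q)) volume c d :=
    (hF.comp (by fun_prop : Continuous fun ξ : ℝ => (ξ, q))).intervalIntegrable c d
  simp only [integral_Ici_eq_integral_Ioi]
  refine tendstoUniformly_intervalIntegral_Ioi_of_dominated
    (g := fun ρ => Real.exp b * Real.exp (-(∫ ξ in x₀..ρ, F (ξ, p₀)))) ?_ (fun q => ?_)
    ((hint.mono_set Ioi_subset_Ici_self).const_mul _) (fun q ρ hρ => ?_)
  · exact Filter.tendsto_atTop_add_const_left _ _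
      (tendsto_natCast_atTop_atTop.atTop_mul_const hs)
  · exact (Real.continuous_exp.comp
      (intervalIntegral.continuous_primitive (hFi q) x₀).neg).aestronglyMeasurable
  · rw [Real.norm_eq_abs, Real.abs_exp, ← Real.exp_add, Real.exp_le_exp]
    have h := hbd q ρ (le_of_lt hρ)
    rw [intervalIntegral.integral_sub (hFi q x₀ ρ) (hFi p₀ x₀ ρ)] at h
    linarith [(abs_le.1 h).1]
end

section
/- Let U ⊆ ℝ × ℝ be open and connected, and let f : ℝ × ℝ → ℝ be real-analytic on U. Suppose (t₀, s₀) ∈ U and there exists ε > 0 such that {t₀} × (s₀ − ε, s₀ + ε) ⊆ U and, for every n ∈ ℕ and every s ∈ (s₀ − ε, s₀ + ε), the derivative with respect to s of the function s ↦ (∂ⁿf/∂tⁿ)(t₀, s) vanishes. Then ∂f/∂s vanishes identically on U. -/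
/-- The `n`-th partial derivative in the first variable of a function analytic on an open set is
analytic there. -/
theorem AnalyticOnNhd.iterate_deriv_fst {U : Set (ℝ × ℝ)} {f : ℝ × ℝ → ℝ}
    (hf : AnalyticOnNhd ℝ f U) (hU : IsOpen U) (n : ℕ) :
    AnalyticOnNhd ℝ (fun p : ℝ × ℝ => deriv^[n] (fun t => f (t, p.2)) p.1) U := by
  induction n with
  | zero => simpa using hf
  | succ n ih =>
    have h : AnalyticOnNhd ℝ (fun p => fderiv ℝ
        (fun p : ℝ × ℝ => deriv^[n] (fun t => f (t, p.2)) p.1) p (1, 0)) U := fun p hp =>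
      (ContinuousLinearMap.apply ℝ ℝ ((1, 0) : ℝ × ℝ)).analyticAt _ |>.comp (ih.fderiv p hp)
    refine h.congr hU fun p hp => ?_
    have h1 := (ih p hp).differentiableAt.hasFDerivAt.comp_hasDerivAt p.1
      ((hasDerivAt_id p.1).prodMk (hasDerivAt_const p.1 p.2))
    simp only [Function.iterate_succ_apply']
    exact h1.deriv.symm

/-- The second partial derivative is given by the total derivative. -/
theorem DifferentiableAt.hasDerivAt_snd {f : ℝ × ℝ → ℝ} {p : ℝ × ℝ}
    (hf : DifferentiableAt ℝ f p) :
    HasDerivAt (fun s => f (p.1, s)) (fderiv ℝ f p (0, 1)) p.2 :=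
  hf.hasFDerivAt.comp_hasDerivAt p.2 ((hasDerivAt_const p.2 p.1).prodMk (hasDerivAt_id p.2))

/-- Functions of one real variable analytic at a point with the same derivatives of all orders
there agree near that point. -/
theorem AnalyticAt.eventuallyEq_of_iterate_deriv_eq {g h : ℝ → ℝ} {t : ℝ}
    (hg : AnalyticAt ℝ g t) (hh : AnalyticAt ℝ h t)
    (heq : ∀ n : ℕ, deriv^[n] g t = deriv^[n] h t) : g =ᶠ[nhds t] h := by
  have h1 := hg.hasFPowerSeriesAt
  have h2 := hh.hasFPowerSeriesAt
  simp only [iteratedDeriv_eq_iterate, heq] at h1 h2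
  filter_upwards [h1.eventually_hasSum_sub, h2.eventually_hasSum_sub] with z hz1 hz2
  exact hz1.unique hz2

theorem analytic_vanishing_of_s_derivatives_propagates
    (U : Set (ℝ × ℝ)) (hU : IsOpen U) (hconn : IsConnected U)
    (f : ℝ × ℝ → ℝ) (hf : AnalyticOnNhd ℝ f U)
    (t₀ s₀ : ℝ) (hmem : (t₀, s₀) ∈ U) (ε : ℝ) (hε : 0 < ε)
    (hseg : ({t₀} : Set ℝ) ×ˢ Set.Ioo (s₀ - ε) (s₀ + ε) ⊆ U)
    (hvanish : ∀ n : ℕ, ∀ s ∈ Set.Ioo (s₀ - ε) (s₀ + ε),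
      deriv (fun s' => deriv^[n] (fun t => f (t, s')) t₀) s = 0) :
    ∀ p ∈ U, deriv (fun s => f (p.1, s)) p.2 = 0 := by
  have hs₀ : s₀ ∈ Set.Ioo (s₀ - ε) (s₀ + ε) := ⟨by linarith, by linarith⟩
  have hconst : ∀ n : ℕ, ∀ s ∈ Set.Ioo (s₀ - ε) (s₀ + ε),
      deriv^[n] (fun t => f (t, s)) t₀ = deriv^[n] (fun t => f (t, s₀)) t₀ := by
    intro n s hs
    refine isOpen_Ioo.is_const_of_deriv_eq_zero isPreconnected_Ioo
      (f := fun s' => deriv^[n] (fun t => f (t, s')) t₀) (fun x hx => ?_)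
      (fun x hx => hvanish n x hx) hs hs₀
    exact (hf.iterate_deriv_fst hU n (t₀, x) (hseg ⟨rfl, hx⟩)).differentiableAt.hasDerivAt_snd
      |>.differentiableAt.differentiableWithinAt
  obtain ⟨r, hr, hball⟩ := Metric.isOpen_iff.1 hU _ hmem
  have hprod : ∀ t ∈ Metric.ball t₀ r, ∀ s ∈ Metric.ball s₀ r, (t, s) ∈ U := fun t ht s hs =>
    hball (by rw [← ball_prod_same]; exact ⟨ht, hs⟩)
  have hline : ∀ s ∈ Metric.ball s₀ r,
      AnalyticOnNhd ℝ (fun t => f (t, s)) (Metric.ball t₀ r) := fun s hs t ht =>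
    (hf _ (hprod t ht s hs)).comp₂ analyticAt_id analyticAt_const
  have hindep : ∀ s ∈ Metric.ball s₀ r ∩ Set.Ioo (s₀ - ε) (s₀ + ε), ∀ t ∈ Metric.ball t₀ r,
      f (t, s) = f (t, s₀) := by
    intro s hs
    have h1 := hline s hs.1
    have h2 := hline s₀ (Metric.mem_ball_self hr)
    have ht₀ := Metric.mem_ball_self (x := t₀) hr
    exact h1.eqOn_of_preconnected_of_eventuallyEq h2 (convex_ball t₀ r).isPreconnected ht₀
      ((h1 _ ht₀).eventuallyEq_of_iterate_deriv_eq (h2 _ ht₀) fun n => hconst n s hs.2)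
  have hderiv : AnalyticOnNhd ℝ (fun p => fderiv ℝ f p (0, 1)) U := fun p hp =>
    (ContinuousLinearMap.apply ℝ ℝ ((0, 1) : ℝ × ℝ)).analyticAt _ |>.comp (hf.fderiv p hp)
  have hlocal : (fun p => fderiv ℝ f p (0, 1)) =ᶠ[nhds (t₀, s₀)] 0 := by
    have hV : IsOpen (Metric.ball s₀ r ∩ Set.Ioo (s₀ - ε) (s₀ + ε)) :=
      Metric.isOpen_ball.inter isOpen_Ioo
    filter_upwards [prod_mem_nhds (Metric.ball_mem_nhds t₀ hr)
      (hV.mem_nhds ⟨Metric.mem_ball_self hr, hs₀⟩)] with p hp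
    have hpU : p ∈ U := hprod p.1 hp.1 p.2 hp.2.1
    refine (hf p hpU).differentiableAt.hasDerivAt_snd.unique
      ((hasDerivAt_const p.2 (f (p.1, s₀))).congr_of_eventuallyEq ?_)
    filter_upwards [hV.mem_nhds hp.2] with s hs using hindep s hs p.1 hp.1
  intro p hp
  rw [(hf p hp).differentiableAt.hasDerivAt_snd.deriv]
  exact hderiv.eqOn_zero_of_preconnected_of_eventuallyEq_zero hconn.isPreconnected hmem hlocal hp
end
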